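/- For every admissible update sequence U, after the SF_F-sketch processes U starting from all-zero subsketches, every counter of the Slim-subsketch is at most the largest counter in the corresponding bucket of the Fat-subsketch: for all i : Fin d and j : Fin w, A i j ≤ max over k : Fin z of B i j k. (Appendix I, Theorem 2.) -/

import Mathlib

/-- An update operation: insertion or deletion of an item. -/
inductive SketchOp (ι : Type) where
  | ins (e : ι)
  | del (e : ι)
deriving DecidableEq

/-- The state of the SF_F-sketch: a Slim-subsketch `A` and a Fat-subsketch `B`. -/
structure SFFState (d w z : ℕ) where
  A : Fin d → Fin w → ℕ
  B : Fin d → Fin w → Fin z → ℕ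

/-- One update step of the SF_F-sketch.

Insertion of `e`: first each counter `B i (h i e) (g i e)` is incremented by 1;
then, with `Bmin` the minimum over `i` of the updated `B i (h i e) (g i e)`,
every Slim counter `A i (h i e)` whose value equals the minimum over `i'` of
`A i' (h i' e)` and is `< Bmin` is incremented by 1; other Slim counters are
unchanged.

Deletion of `e`: each counter `B i (h i e) (g i e)` is decremented by 1; then
each Slim counter `A i (h i e)` is replaced by
`min (A i (h i e)) (max over k of the updated B i (h i e) k)`. -/
def sffStep {ι : Type} {d w z : ℕ} [NeZero d] (h : Fin d → ι → Fin w)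
    (g : Fin d → ι → Fin z) (st : SFFState d w z) : SketchOp ι → SFFState d w z
  | .ins e =>
      let B' : Fin d → Fin w → Fin z → ℕ :=
        fun i j k => if j = h i e ∧ k = g i e then st.B i j k + 1 else st.B i j k
      let Bmin := Finset.univ.inf' Finset.univ_nonempty
        (fun i => B' i (h i e) (g i e))
      let Amin := Finset.univ.inf' Finset.univ_nonempty
        (fun i' => st.A i' (h i' e))
      let A' : Fin d → Fin w → ℕ :=
        fun i j =>
          if j = h i e ∧ st.A i (h i e) = Amin ∧ st.A i (h i e) < Bmin then
            st.A i j + 1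
          else st.A i j
      ⟨A', B'⟩
  | .del e =>
      let B' : Fin d → Fin w → Fin z → ℕ :=
        fun i j k => if j = h i e ∧ k = g i e then st.B i j k - 1 else st.B i j k
      let A' : Fin d → Fin w → ℕ :=
        fun i j =>
          if j = h i e then
            min (st.A i j) (Finset.univ.sup (fun k : Fin z => B' i (h i e) k))
          else st.A i j
      ⟨A', B'⟩

/-- The state of the SF_F-sketch after processing the update sequence `U`
starting from all-zero subsketches. -/
def sffProcess {ι : Type} {d w z : ℕ} [NeZero d] (h : Fin d → ι → Fin w)
    (g : Fin d → ι → Fin z) (U : List (SketchOp ι)) : SFFState d w z :=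
  U.foldl (sffStep h g) ⟨fun _ _ => 0, fun _ _ _ => 0⟩

/-- The invariant is preserved by every step. -/
theorem sffStep_inv {ι : Type} {d w z : ℕ} [NeZero d] (h : Fin d → ι → Fin w)
    (g : Fin d → ι → Fin z) (st : SFFState d w z) (op : SketchOp ι)
    (H : ∀ i j, st.A i j ≤ Finset.univ.sup (fun k : Fin z => st.B i j k)) (i : Fin d) (j : Fin w) :
    (sffStep h g st op).A i j
      ≤ Finset.univ.sup (fun k : Fin z => (sffStep h g st op).B i j k) := by
  cases op with
  | ins e =>
    simp only [sffStep, and_self, if_true, true_and]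
    split_ifs with hc
    · obtain ⟨rfl, -, hlt⟩ := hc
      have h1 := Finset.inf'_le (fun i => st.B i (h i e) (g i e) + 1) (Finset.mem_univ i)
      have h2 := Finset.le_sup (f := fun k : Fin z => if h i e = h i e ∧ k = g i e then
        st.B i (h i e) k + 1 else st.B i (h i e) k) (Finset.mem_univ (g i e))
      simp only [and_self, if_true, true_and] at h2 ⊢
      exact (Nat.succ_le_of_lt hlt).trans (h1.trans h2)
    · refine (H i j).trans (Finset.sup_mono_fun fun k _ => ?_)
      split_ifs <;> omega
  | del e =>
    simp only [sffStep, and_self, if_true, true_and]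
    by_cases hj : j = h i e
    · subst hj
      simp only [if_true, true_and]
      exact min_le_right _ _
    · simpa [hj] using H i j

/-- Appendix I, Theorem 2: for every admissible update sequence (immediately
before every deletion of an item `e`, all Fat counters `B i (h i e) (g i e)` are
at least 1), after processing the sequence every Slim counter is at most the
largest counter in the corresponding bucket of the Fat-subsketch. -/
theorem sff_slim_le_max_fat {ι : Type} {d w z : ℕ} [NeZero d] [NeZero w]
    [NeZero z] (h : Fin d → ι → Fin w) (g : Fin d → ι → Fin z)
    (U : List (SketchOp ι))
    (hadm : ∀ (V : List (SketchOp ι)) (e : ι) (rest : List (SketchOp ι)),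
      U = V ++ SketchOp.del e :: rest →
      ∀ i : Fin d, 1 ≤ (sffProcess h g V : SFFState d w z).B i (h i e) (g i e)) :
    ∀ (i : Fin d) (j : Fin w),
      (sffProcess h g U : SFFState d w z).A i j
        ≤ Finset.univ.sup (fun k : Fin z => (sffProcess h g U).B i j k) := by
  clear hadm
  induction U using List.reverseRecOn with
  | nil => intro i j; simp [sffProcess]
  | append_singleton V op ih =>
    have e : (sffProcess h g (V ++ [op]) : SFFState d w z) = sffStep h g (sffProcess h g V) op := by
      simp [sffProcess]
    rw [e]
    exact sffStep_inv h g _ op ih
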